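/- Let c > 0 and σ > 0, and define g₁(t) = 0 for t ≤ 0 and g₁(t) = (σ²/c²)(e^{tc} − 1 − tc) for t > 0. Then for every ε ≥ 0, sup_{t∈ℝ} ( tε − g₁(t) ) = (σ²/c²)·h₁(cε/σ²), where h₁(u) = (1+u)log(1+u) − u. -/

import Mathlib

/-- The Fenchel–Young inequality for the exponential. -/
theorem mul_sub_exp_le_mul_log_sub {x : ℝ} (hx : 0 < x) (s : ℝ) :
    x * s - Real.exp s ≤ x * Real.log x - x := by
  have hexp : Real.exp s = x * Real.exp (s - Real.log x) := by
    rw [Real.exp_sub, Real.exp_log hx]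
    field_simp
  have hle := mul_le_mul_of_nonneg_left (Real.add_one_le_exp (s - Real.log x)) hx.le
  rw [← hexp] at hle
  linarith

/-- **Fenchel conjugate of the Bennett exponent.** With
`g₁(t) = 0` for `t ≤ 0` and `g₁(t) = (σ²/c²)(e^{tc} - 1 - tc)` for `t > 0`, for every
`ε ≥ 0`, `sup_{t ∈ ℝ} (tε - g₁(t)) = (σ²/c²) h₁(cε/σ²)` where
`h₁(u) = (1+u)log(1+u) - u`. -/
theorem fenchel_conjugate_bennett (c σ : ℝ) (hc : 0 < c) (hσ : 0 < σ) (ε : ℝ) (hε : 0 ≤ ε) :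
    (⨆ t : ℝ,
        (t * ε - if t ≤ 0 then 0 else σ ^ 2 / c ^ 2 * (Real.exp (t * c) - 1 - t * c))) =
      σ ^ 2 / c ^ 2 *
        ((1 + c * ε / σ ^ 2) * Real.log (1 + c * ε / σ ^ 2) - c * ε / σ ^ 2) := by
  have ha : 0 < σ ^ 2 / c ^ 2 := by positivity
  have hu : 0 ≤ c * ε / σ ^ 2 := by positivity
  have hau : ε = σ ^ 2 / c ^ 2 * (c * (c * ε / σ ^ 2)) := by field_simp
  generalize c * ε / σ ^ 2 = u at *
  generalize σ ^ 2 / c ^ 2 = a at *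
  subst hau
  have hx : 0 < 1 + u := by linarith
  refine IsGreatest.csSup_eq ⟨⟨Real.log (1 + u) / c, ?_⟩, ?_⟩
  · have hs : Real.log (1 + u) / c * c = Real.log (1 + u) := div_mul_cancel₀ _ hc.ne'
    dsimp only
    split_ifs with ht
    · have hlog : Real.log (1 + u) = 0 :=
        le_antisymm (by simpa [hs] using mul_le_mul_of_nonneg_right ht hc.le)
          (Real.log_nonneg (by linarith))
      have hu0 : u = 0 := by
        have := Real.exp_log hx
        rw [hlog, Real.exp_zero] at this
        linarith
      simp [hu0]
    · rw [hs, Real.exp_log hx]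
      linear_combination a * u * hs
  · rintro _ ⟨t, rfl⟩
    dsimp only
    split_ifs with ht
    · have h := mul_le_mul_of_nonneg_left (mul_sub_exp_le_mul_log_sub hx 0) ha.le
      rw [Real.exp_zero] at h
      have := mul_nonpos_of_nonpos_of_nonneg ht hε
      linarith
    · have h := mul_le_mul_of_nonneg_left (mul_sub_exp_le_mul_log_sub hx (t * c)) ha.le
      linarith
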